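/- arXiv:2512.02279 — 6 statements merged into one kernel-verified Lean document; each statement's English description precedes it below -/
import Mathlib

section
/- Let f be a random p-biased function on 𝒳 and define Z = Σ_{x∈𝒳} 𝒟_x(x)·[(1−p)·y(x)·f(x) + p·(1−y(x))·(1−f(x))]. Then E[Z] = p(1−p), and for every δ ≥ 0, with probability at least 1 − 2·exp(−2δ²·p²(1−p)² / ‖𝒟_x‖₂²) over the randomness of f, it holds that |Z − p(1−p)| ≤ δ·p(1−p). -/
open Finset Real
open scoped Classical BigOperators

noncomputable section

/-- The real value of a boolean function at a point: `1` if `true`, `0` if `false`. -/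
def bval {X : Type} (f : X → Bool) (x : X) : ℝ := if f x then 1 else 0

/-- The probability weight of a particular function `f : X → Bool` when each value
`f x` is an independent Bernoulli(p) random variable. -/
def bweight {X : Type} [Fintype X] (p : ℝ) (f : X → Bool) : ℝ :=
  ∏ x, if f x then p else 1 - p

/-- The probability of an event `P` under a random `p`-biased function. -/
def bprob (X : Type) [Fintype X] (p : ℝ) (P : (X → Bool) → Prop) : ℝ :=
  ∑ f : X → Bool, bweight p f * (if P f then 1 else 0)

/-- The squared 2-norm of a weight function. -/
def norm2sq {X : Type} [Fintype X] (w : X → ℝ) : ℝ := ∑ x, w x ^ 2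

/-- The normalization factor `Z`. -/
def Zval {X : Type} [Fintype X] (Dx yy : X → ℝ) (p : ℝ) (f : X → Bool) : ℝ :=
  ∑ x, Dx x * ((1 - p) * yy x * bval f x + p * (1 - yy x) * (1 - bval f x))


lemma hoeff2 (p s : ℝ) (hp0 : 0 ≤ p) (hp1 : p ≤ 1) :
    p * exp (s * (1 - p)) + (1 - p) * exp (s * (0 - p)) ≤ exp (s ^ 2 / 8) := by
  let μ : MeasureTheory.Measure Bool :=
    ENNReal.ofReal p • MeasureTheory.Measure.dirac true +
      ENNReal.ofReal (1 - p) • MeasureTheory.Measure.dirac false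
  have hq : 0 ≤ 1 - p := by linarith
  have hint : ∀ g : Bool → ℝ, ∫ b, g b ∂μ = p * g true + (1 - p) * g false := by
    intro g
    rw [MeasureTheory.integral_add_measure]
    · simp [MeasureTheory.integral_smul_measure, hp0, hq]
    · exact (MeasureTheory.integrable_dirac (by simp)).smul_measure (by simp)
    · exact (MeasureTheory.integrable_dirac (by simp)).smul_measure (by simp)
  haveI : MeasureTheory.IsProbabilityMeasure μ := by
    constructor
    simp only [μ, MeasureTheory.Measure.add_apply, MeasureTheory.Measure.smul_apply,
      MeasureTheory.measure_univ, smul_eq_mul, mul_one]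
    rw [← ENNReal.ofReal_add hp0 hq]
    simp
  have h := ProbabilityTheory.hasSubgaussianMGF_of_mem_Icc_of_integral_eq_zero
    (μ := μ) (X := fun b : Bool => (if b then 1 else 0) - p) (a := 0 - p) (b := 1 - p)
    (Measurable.of_discrete.aemeasurable)
    (MeasureTheory.ae_of_all _ (fun b => by cases b <;> simp))
    (by rw [hint]; simp; ring)
  have h2 := h.mgf_le s
  rw [ProbabilityTheory.mgf, hint] at h2
  simp only [if_true, Bool.false_eq_true, if_false] at h2
  refine h2.trans (le_of_eq ?_)
  congr 1
  simp
  ring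

lemma sum_prod_bool {X : Type} [Fintype X] (g : X → Bool → ℝ) :
    ∑ f : X → Bool, ∏ x, g x (f x) = ∏ x, (g x true + g x false) := by
  have := Finset.prod_univ_sum (fun _ : X => (Finset.univ : Finset Bool)) g
  rw [Fintype.piFinset_univ] at this
  rw [← this]
  simp

lemma sum_bweight {X : Type} [Fintype X] (p : ℝ) :
    ∑ f : X → Bool, bweight p f = 1 := by
  unfold bweight
  rw [sum_prod_bool (fun _ b => if b then p else 1 - p)]
  simp

lemma bweight_nonneg {X : Type} [Fintype X] (p : ℝ) (hp0 : 0 ≤ p) (hp1 : p ≤ 1)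
    (f : X → Bool) : 0 ≤ bweight p f := by
  unfold bweight
  refine Finset.prod_nonneg (fun x _ => ?_)
  split_ifs <;> linarith

lemma sum_bweight_single {X : Type} [Fintype X] (p : ℝ) (x : X) :
    ∑ f : X → Bool, bweight p f * (bval f x - p) = 0 := by
  have h : ∀ f : X → Bool, bweight p f * (bval f x - p) =
      ∏ z, (fun z b => (if b then p else 1 - p) *
        (if z = x then ((if b then 1 else 0) - p) else 1) : X → Bool → ℝ) z (f z) := by
    intro f
    simp only [Finset.prod_mul_distrib]
    rw [Finset.prod_ite_eq' Finset.univ x]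
    simp [bweight, bval]
  rw [Finset.sum_congr rfl (fun f _ => h f), sum_prod_bool (fun z b => (if b then p else 1 - p) *
        (if z = x then ((if b then 1 else 0) - p) else 1) : X → Bool → ℝ)]
  apply Finset.prod_eq_zero (Finset.mem_univ x)
  simp
  ring

lemma Zval_eq {X : Type} [Fintype X] (Dx yy : X → ℝ) (p : ℝ) (hDxsum : ∑ x, Dx x = 1)
    (f : X → Bool) :
    Zval Dx yy p f = p * (1 - p) + ∑ x, (Dx x * (yy x - p)) * (bval f x - p) := by
  have : p * (1 - p) = ∑ x, Dx x * (p * (1 - p)) := by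
    rw [← Finset.sum_mul, hDxsum, one_mul]
  rw [this, ← Finset.sum_add_distrib]
  unfold Zval
  refine Finset.sum_congr rfl (fun x _ => ?_)
  ring

lemma mgf_bound {X : Type} [Fintype X] (c : X → ℝ) (p l : ℝ) (hp0 : 0 ≤ p) (hp1 : p ≤ 1) :
    ∑ f : X → Bool, bweight p f * exp (l * ∑ x, c x * (bval f x - p)) ≤
      exp (l ^ 2 * (∑ x, c x ^ 2) / 8) := by
  have h : ∀ f : X → Bool, bweight p f * exp (l * ∑ x, c x * (bval f x - p)) =
      ∏ z, (fun z b => (if b then p else 1 - p) *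
        exp ((l * c z) * ((if b then 1 else 0) - p)) : X → Bool → ℝ) z (f z) := by
    intro f
    simp only [Finset.prod_mul_distrib]
    rw [← Real.exp_sum, Finset.mul_sum]
    simp only [bweight, bval, mul_assoc]
  rw [Finset.sum_congr rfl (fun f _ => h f), sum_prod_bool (fun z b => (if b then p else 1 - p) *
        exp ((l * c z) * ((if b then 1 else 0) - p)) : X → Bool → ℝ)]
  have e : exp (l ^ 2 * (∑ x, c x ^ 2) / 8) = ∏ x, exp ((l * c x) ^ 2 / 8) := by
    rw [← Real.exp_sum, Finset.mul_sum, Finset.sum_div]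
    simp only [mul_pow]
  rw [e]
  refine Finset.prod_le_prod (fun x _ => ?_) (fun x _ => ?_)
  · have : 0 ≤ 1 - p := by linarith
    simp only [if_true, Bool.false_eq_true, if_false]
    positivity
  · simpa using hoeff2 p (l * c x) hp0 hp1

theorem stmt0 {X : Type} [Fintype X] (Dx yy : X → ℝ) (p : ℝ)
    (hDx0 : ∀ x, 0 ≤ Dx x) (hDx1 : ∀ x, Dx x ≤ 1) (hDxsum : ∑ x, Dx x = 1)
    (hy0 : ∀ x, 0 ≤ yy x) (hy1 : ∀ x, yy x ≤ 1)
    (hp0 : 0 ≤ p) (hp1 : p ≤ 1) :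
    (∑ f : X → Bool, bweight p f * Zval Dx yy p f) = p * (1 - p) ∧
    ∀ δ : ℝ, 0 ≤ δ →
      bprob X p (fun f => |Zval Dx yy p f - p * (1 - p)| ≤ δ * (p * (1 - p))) ≥
        1 - 2 * Real.exp (-(2 * δ ^ 2 * p ^ 2 * (1 - p) ^ 2) / norm2sq Dx) := by
  refine ⟨?_, ?_⟩
  · simp only [Zval_eq Dx yy p hDxsum, mul_add, Finset.sum_add_distrib]
    rw [← Finset.sum_mul, sum_bweight, one_mul]
    simp only [Finset.mul_sum]
    rw [Finset.sum_comm, Finset.sum_eq_zero, add_zero]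
    intro x _
    have : ∀ f : X → Bool, bweight p f * (Dx x * (yy x - p) * (bval f x - p)) =
        (Dx x * (yy x - p)) * (bweight p f * (bval f x - p)) := fun f => by ring
    rw [Finset.sum_congr rfl (fun f _ => this f), ← Finset.mul_sum, sum_bweight_single, mul_zero]
  · intro δ hδ
    set c : X → ℝ := fun x => Dx x * (yy x - p) with hc
    set V := norm2sq Dx with hV
    set t := δ * (p * (1 - p)) with ht
    have hq : 0 ≤ 1 - p := by linarith
    have ht0 : 0 ≤ t := by positivity
    have hVpos : 0 < V := by
      have h0 : 0 ≤ V := Finset.sum_nonneg (fun x _ => sq_nonneg _)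
      refine lt_of_le_of_ne h0 (fun h => ?_)
      have h1 : ∀ x, Dx x = 0 := by
        intro x
        have := (Finset.sum_eq_zero_iff_of_nonneg
          (fun x _ => sq_nonneg (Dx x))).1 h.symm x (Finset.mem_univ x)
        exact pow_eq_zero_iff (two_ne_zero) |>.1 this
      simp [h1] at hDxsum
    have hcV : ∑ x, c x ^ 2 ≤ V := by
      refine Finset.sum_le_sum (fun x _ => ?_)
      have : (yy x - p) ^ 2 ≤ 1 := by
        have := hy0 x; have := hy1 x
        rw [sq_le_one_iff_abs_le_one, abs_le]
        constructor <;> linarith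
      simp only [hc, mul_pow]
      exact mul_le_of_le_one_right (sq_nonneg _) this
    set E := Real.exp (-(2 * δ ^ 2 * p ^ 2 * (1 - p) ^ 2) / V) with hE
    have key : ∀ l : ℝ, l ^ 2 = (4 * t / V) ^ 2 →
        ∑ f : X → Bool, bweight p f *
          exp (l * ∑ x, c x * (bval f x - p)) * exp (-(4 * t / V * t)) ≤ E := by
      intro l hl
      rw [← Finset.sum_mul]
      calc _ ≤ exp (l ^ 2 * (∑ x, c x ^ 2) / 8) * exp (-(4 * t / V * t)) := by
            gcongr
            exact mgf_bound c p l hp0 hp1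
        _ ≤ exp (l ^ 2 * V / 8) * exp (-(4 * t / V * t)) := by gcongr
        _ = E := by
            rw [← Real.exp_add, hE, hl, ht]
            congr 1
            field_simp
            ring
    have k1 := key (4 * t / V) rfl
    have k2 := key (-(4 * t / V)) (by ring)
    have hl0 : 0 ≤ 4 * t / V := by positivity
    have pt : ∀ f : X → Bool, bweight p f ≤
        bweight p f * (if |Zval Dx yy p f - p * (1 - p)| ≤ t then 1 else 0) +
        (bweight p f * exp (4 * t / V * ∑ x, c x * (bval f x - p)) * exp (-(4 * t / V * t)) +
        bweight p f * exp (-(4 * t / V) * ∑ x, c x * (bval f x - p)) *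
          exp (-(4 * t / V * t))) := by
      intro f
      have hw := bweight_nonneg p hp0 hp1 f
      rw [Zval_eq Dx yy p hDxsum, add_sub_cancel_left]
      set S := ∑ x, c x * (bval f x - p) with hS
      rw [mul_assoc, mul_assoc, ← mul_add, ← mul_add, ← Real.exp_add, ← Real.exp_add]
      refine le_mul_of_one_le_right hw ?_
      have e1 := Real.exp_pos (4 * t / V * S + -(4 * t / V * t))
      have e2 := Real.exp_pos (-(4 * t / V) * S + -(4 * t / V * t))
      split_ifs with hh
      · linarith
      · rw [not_le, lt_abs] at hh
        rcases hh with hh | hh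
        · have := Real.one_le_exp (x := 4 * t / V * S + -(4 * t / V * t)) (by nlinarith)
          linarith
        · have := Real.one_le_exp (x := -(4 * t / V) * S + -(4 * t / V * t)) (by nlinarith)
          linarith
    have := Finset.sum_le_sum (fun f (_ : f ∈ (Finset.univ : Finset (X → Bool))) => pt f)
    rw [sum_bweight, Finset.sum_add_distrib, Finset.sum_add_distrib] at this
    unfold bprob
    linarith

end
end

section
/- There is an absolute constant c > 0 with the following property. Let f be a random p-biased function on 𝒳 with p ∈ (0,1), let g : 𝒳 → {0,1} be an arbitrary fixed function, and let δ ∈ (0,1]. Then with probability at least 1 − 3·exp(−c·δ²·p²(1−p)² / ‖𝒟_x‖₂²) over the randomness of f, the normalization factor Z is strictly positive and the filtered sample distribution 𝒟 satisfies Pr_{x∼𝒟}[g(x) ≠ f(x)] ≤ Pr_{(x,y)∼𝒟_ref}[g(x) ≠ y] + δ. -/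
open Finset Real
open scoped Classical BigOperators

noncomputable section

/-- The filtered sample distribution. -/
def filtered {X : Type} [Fintype X] (Dx yy : X → ℝ) (p : ℝ) (f : X → Bool) (x : X) : ℝ :=
  Dx x * ((1 - p) * yy x * bval f x + p * (1 - yy x) * (1 - bval f x)) / Zval Dx yy p f

lemma aux_exp (x : ℝ) : Real.exp x ≤ x + Real.exp (x ^ 2) := by
  have h0 : x ^ 2 + 1 ≤ Real.exp (x ^ 2) := Real.add_one_le_exp _
  rcases le_or_gt |x| 1 with h | h
  · have := (abs_le.mp (Real.abs_exp_sub_one_sub_id_le h)).2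
    linarith
  · rcases lt_abs.mp h with h | h
    · have : Real.exp x ≤ Real.exp (x ^ 2) := Real.exp_le_exp.mpr (by nlinarith)
      linarith
    · have : Real.exp x ≤ 1 := Real.exp_le_one_iff.mpr (by linarith)
      nlinarith

lemma aux_two (p a b B : ℝ) (hp : 0 ≤ p) (hp1 : p ≤ 1) (ha : |a| ≤ B) (hb : |b| ≤ B) :
    p * Real.exp a + (1 - p) * Real.exp b ≤
      Real.exp ((p * a + (1 - p) * b) + 4 * B ^ 2) := by
  set m := p * a + (1 - p) * b with hm
  obtain ⟨ha1, ha2⟩ := abs_le.mp ha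
  obtain ⟨hb1, hb2⟩ := abs_le.mp hb
  have hm1 : -B ≤ m := by nlinarith
  have hm2 : m ≤ B := by nlinarith
  have key : ∀ z, -B ≤ z → z ≤ B → Real.exp z ≤ Real.exp m * ((z - m) + Real.exp (4 * B ^ 2)) := by
    intro z h1 h2
    have e : Real.exp z = Real.exp m * Real.exp (z - m) := by rw [← Real.exp_add]; ring_nf
    rw [e]
    apply mul_le_mul_of_nonneg_left _ (Real.exp_pos _).le
    have h3 := aux_exp (z - m)
    have h4 : Real.exp ((z - m) ^ 2) ≤ Real.exp (4 * B ^ 2) :=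
      Real.exp_le_exp.mpr (by nlinarith)
    linarith
  have k1 := mul_le_mul_of_nonneg_left (key a ha1 ha2) hp
  have k2 := mul_le_mul_of_nonneg_left (key b hb1 hb2) (sub_nonneg.mpr hp1)
  rw [Real.exp_add]
  calc _ ≤ _ := add_le_add k1 k2
    _ = Real.exp m * ((p * a + (1 - p) * b) - m + Real.exp (4 * B ^ 2)) := by ring
    _ = _ := by rw [← hm]; ring

lemma aux_prod {X : Type} [Fintype X] (p : ℝ) (F : X → Bool → ℝ) :
    ∑ f : X → Bool, bweight p f * ∏ x, F x (f x) =
      ∏ x, (p * F x true + (1 - p) * F x false) := by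
  have := Finset.prod_univ_sum (fun _ : X => (Finset.univ : Finset Bool))
    (fun x b => (if b then p else 1 - p) * F x b)
  simp only [Fintype.piFinset_univ, Fintype.sum_bool] at this
  simp only [if_true, Bool.false_eq_true, if_false] at this
  rw [this]
  refine Finset.sum_congr rfl fun f _ => ?_
  rw [bweight, Finset.prod_mul_distrib]

lemma aux_hoeff {X : Type} [Fintype X] (p q : ℝ) (h : X → Bool → ℝ) (D : X → ℝ) 
    (hp : 0 ≤ p) (hp1 : p ≤ 1) (hq : 0 ≤ q) (hS : 0 < norm2sq D)
    (hB : ∀ x b, |h x b| ≤ 2 * D x)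
    (hmean : ∑ x, (p * h x true + (1 - p) * h x false) = - q) (P : (X → Bool) → Prop)
    (hP : ∀ f, ∑ x, h x (f x) < 0 → P f) :
    1 - Real.exp (- q ^ 2 / (64 * norm2sq D)) ≤ bprob X p P := by
  set S := norm2sq D with hSd
  set t := q / (32 * S) with ht
  have ht0 : 0 ≤ t := by positivity
  have hw : ∀ f : X → Bool, 0 ≤ bweight p f := fun f => by
    refine Finset.prod_nonneg fun x _ => ?_
    split_ifs <;> linarith
  have h1 : ∑ f : X → Bool, bweight p f = 1 := by
    have := aux_prod (X := X) p (fun _ _ => 1)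
    simpa using this
  have h2 : ∑ f : X → Bool, bweight p f * ∏ x, Real.exp (t * h x (f x)) ≤
      Real.exp (- q ^ 2 / (64 * S)) := by
    rw [aux_prod p (fun x b => Real.exp (t * h x b))]
    calc _ ≤ ∏ x, Real.exp ((p * (t * h x true) + (1 - p) * (t * h x false))
            + 4 * (t * (2 * D x)) ^ 2) := by
          refine Finset.prod_le_prod (fun x _ => ?_) (fun x _ => ?_)
          · have := Real.exp_pos (t * h x true)
            have := Real.exp_pos (t * h x false)
            have : 0 ≤ 1 - p := by linarith
            positivity
          · apply aux_two _ _ _ _ hp hp1 <;> rw [abs_mul, abs_of_nonneg ht0] <;>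
              exact mul_le_mul_of_nonneg_left (hB _ _) ht0
      _ = Real.exp (t * ∑ x, (p * h x true + (1 - p) * h x false) + 16 * t ^ 2 * S) := by
          rw [← Real.exp_sum, hSd, norm2sq, Finset.mul_sum, Finset.mul_sum,
            ← Finset.sum_add_distrib]
          congr 1
          refine Finset.sum_congr rfl fun x _ => ?_
          ring
      _ = _ := by
          rw [hmean, ht]
          congr 1
          field_simp
          ring
  have h3 : 1 - bprob X p P ≤ ∑ f : X → Bool, bweight p f * ∏ x, Real.exp (t * h x (f x)) := by
    rw [← h1, bprob, ← Finset.sum_sub_distrib]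
    refine Finset.sum_le_sum fun f _ => ?_
    rw [← mul_one_sub]
    apply mul_le_mul_of_nonneg_left _ (hw f)
    rw [← Real.exp_sum, ← Finset.mul_sum]
    split_ifs with hf
    · simpa using (Real.exp_pos _).le
    · have : 0 ≤ ∑ x, h x (f x) := by
        by_contra hc
        exact hf (hP f (not_le.mp hc))
      simpa using mul_nonneg ht0 this
  linarith

theorem stmt1 : ∃ c : ℝ, 0 < c ∧
    ∀ (X : Type) [Fintype X], ∀ (Dx yy : X → ℝ) (p : ℝ) (g : X → Bool) (δ : ℝ),
      (∀ x, 0 ≤ Dx x) → (∀ x, Dx x ≤ 1) → (∑ x, Dx x) = 1 →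
      (∀ x, 0 ≤ yy x) → (∀ x, yy x ≤ 1) →
      0 < p → p < 1 → 0 < δ → δ ≤ 1 →
      bprob X p (fun f =>
          0 < Zval Dx yy p f ∧
          (∑ x, filtered Dx yy p f x * (if g x ≠ f x then (1 : ℝ) else 0)) ≤
            (∑ x, Dx x * (bval g x * (1 - yy x) + (1 - bval g x) * yy x)) + δ) ≥
        1 - 3 * Real.exp (-(c * δ ^ 2 * p ^ 2 * (1 - p) ^ 2) / norm2sq Dx) := by
  refine ⟨1 / 64, by norm_num, ?_⟩
  intro X _ Dx yy p g δ hD0 hD1 hD hy0 hy1 hp0 hp1 hδ0 hδ1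
  set err := ∑ x, Dx x * (bval g x * (1 - yy x) + (1 - bval g x) * yy x) with herr
  have hg : ∀ x, 0 ≤ bval g x * (1 - yy x) + (1 - bval g x) * yy x ∧
      bval g x * (1 - yy x) + (1 - bval g x) * yy x ≤ 1 := by
    intro x
    have := hy0 x
    have := hy1 x
    unfold bval
    split_ifs <;> constructor <;> linarith
  have he0 : 0 ≤ err := Finset.sum_nonneg fun x _ => mul_nonneg (hD0 x) (hg x).1
  have he1 : err ≤ 1 := by
    rw [← hD]
    exact Finset.sum_le_sum fun x _ => mul_le_of_le_one_right (hD0 x) (hg x).2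
  set w : X → Bool → ℝ := fun x b =>
    (1 - p) * yy x * (if b then 1 else 0) + p * (1 - yy x) * (1 - (if b then 1 else 0)) with hw
  have hw0 : ∀ x b, 0 ≤ w x b ∧ w x b ≤ 1 := by
    intro x b
    have h1 := hy0 x
    have h2 := hy1 x
    cases b <;> simp only [hw] <;> constructor <;> norm_num <;> nlinarith
  have hS : 0 < norm2sq Dx := by
    have h0 : 0 ≤ norm2sq Dx := Finset.sum_nonneg fun x _ => sq_nonneg _
    rcases h0.lt_or_eq with h | h
    · exact h
    · exfalso
      have h' := (Finset.sum_eq_zero_iff_of_nonneg (fun x _ => sq_nonneg (Dx x))).mp h.symm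
      have : ∑ x, Dx x = 0 := Finset.sum_eq_zero fun x hx => by simpa using h' x hx
      linarith
  have main := aux_hoeff p (δ * (p * (1 - p)))
    (fun x b => Dx x * (w x b * ((if g x ≠ b then (1 : ℝ) else 0) - (err + δ)))) Dx
    hp0.le hp1.le (mul_nonneg hδ0.le (mul_nonneg hp0.le (by linarith))) hS ?_ ?_
    (fun f =>
          0 < Zval Dx yy p f ∧
          (∑ x, filtered Dx yy p f x * (if g x ≠ f x then (1 : ℝ) else 0)) ≤
            err + δ) ?_
  · have e : -(1 / 64 * δ ^ 2 * p ^ 2 * (1 - p) ^ 2) / norm2sq Dx =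
        - (δ * (p * (1 - p))) ^ 2 / (64 * norm2sq Dx) := by
      field_simp
    rw [e]
    have := Real.exp_pos (- (δ * (p * (1 - p))) ^ 2 / (64 * norm2sq Dx))
    linarith
  · intro x b
    rw [abs_mul, abs_mul, abs_of_nonneg (hD0 x), abs_of_nonneg (hw0 x b).1, mul_comm]
    apply mul_le_mul_of_nonneg_right _ (hD0 x)
    have : |(if g x ≠ b then (1 : ℝ) else 0) - (err + δ)| ≤ 2 := by
      rw [abs_le]
      split_ifs <;> constructor <;> linarith
    have h0 := abs_nonneg ((if g x ≠ b then (1 : ℝ) else 0) - (err + δ))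
    nlinarith [hw0 x b]
  · have : ∀ x, (p * (Dx x * (w x true * ((if g x ≠ true then (1 : ℝ) else 0) - (err + δ)))) +
        (1 - p) * (Dx x * (w x false * ((if g x ≠ false then (1 : ℝ) else 0) - (err + δ))))) =
        p * (1 - p) * (Dx x * (bval g x * (1 - yy x) + (1 - bval g x) * yy x))
        - p * (1 - p) * (err + δ) * Dx x := by
      intro x
      simp only [hw, bval]
      cases g x <;> simp <;> ring
    rw [Finset.sum_congr rfl fun x _ => this x, Finset.sum_sub_distrib, ← Finset.mul_sum,
      ← Finset.mul_sum, hD, ← herr]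
    ring
  · intro f hf
    have hZ : Zval Dx yy p f = ∑ x, Dx x * w x (f x) := rfl
    have hN : ∀ x, filtered Dx yy p f x = Dx x * w x (f x) / Zval Dx yy p f := fun x => rfl
    have hN0 : 0 ≤ ∑ x, Dx x * w x (f x) * (if g x ≠ f x then (1 : ℝ) else 0) :=
      Finset.sum_nonneg fun x _ => mul_nonneg (mul_nonneg (hD0 x) (hw0 x _).1)
        (by split_ifs <;> norm_num)
    have hs : ∑ x, Dx x * (w x (f x) * ((if g x ≠ f x then (1 : ℝ) else 0) - (err + δ))) =
        ∑ x, Dx x * w x (f x) * (if g x ≠ f x then (1 : ℝ) else 0)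
          - (err + δ) * Zval Dx yy p f := by
      rw [hZ, Finset.mul_sum, ← Finset.sum_sub_distrib]
      refine Finset.sum_congr rfl fun x _ => ?_
      ring
    have hf' := hs ▸ hf
    have hZp : 0 < Zval Dx yy p f := by
      have : 0 < (err + δ) * Zval Dx yy p f := by linarith
      exact pos_of_mul_pos_right this (by linarith)
    refine ⟨hZp, ?_⟩
    have : ∑ x, filtered Dx yy p f x * (if g x ≠ f x then (1 : ℝ) else 0) =
        (∑ x, Dx x * w x (f x) * (if g x ≠ f x then (1 : ℝ) else 0)) / Zval Dx yy p f := by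
      rw [Finset.sum_div]
      refine Finset.sum_congr rfl fun x _ => ?_
      rw [hN]; ring
    rw [this, div_le_iff₀ hZp]
    linarith

end
end

section
/- For every finite set 𝒳 and every permutation π : 𝒳 → 𝒳 with no fixed points, there exists a partition of 𝒳 into three pairwise disjoint sets 𝒳₁, 𝒳₂, 𝒳₃ (with 𝒳 = 𝒳₁ ∪ 𝒳₂ ∪ 𝒳₃) such that for every i ∈ {1,2,3} and any two distinct elements x, x' ∈ 𝒳_i, the four elements x, π(x), x', π(x') are pairwise distinct. -/
open Finset Set

theorem exists_coloring_aux {X : Type} (π : Equiv.Perm X) (hπ : ∀ x, π x ≠ x)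
    (s : Finset X) : ∃ c : X → Fin 3, ∀ x ∈ s, π x ∈ s → c x ≠ c (π x) := by
  classical
  induction s using Finset.induction_on with
  | empty => exact ⟨fun _ => 0, by simp⟩
  | insert a s ha ih =>
    obtain ⟨c, hc⟩ := ih
    have key : ∀ u v : Fin 3, ∃ k : Fin 3, k ≠ u ∧ k ≠ v := by decide
    obtain ⟨k, hk1, hk2⟩ := key (c (π a)) (c (π.symm a))
    refine ⟨Function.update c a k, ?_⟩
    intro x hx hpx
    by_cases h1 : x = a
    · subst h1
      rw [Function.update_self, Function.update_of_ne (hπ x)]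
      exact hk1
    · by_cases h2 : π x = a
      · have h3 : π.symm a = x := by rw [← h2]; simp
        rw [Function.update_of_ne h1, h2, Function.update_self, ← h3]
        exact hk2.symm
      · rw [Function.update_of_ne h1, Function.update_of_ne h2]
        exact hc x (Finset.mem_of_mem_insert_of_ne hx h1)
          (Finset.mem_of_mem_insert_of_ne hpx h2)

/-- For every finite set and every fixed-point-free permutation `π`, the domain can be
partitioned into three sets such that within each set, for any two distinct elements
`x, x'`, the four elements `x, π x, x', π x'` are pairwise distinct. -/
theorem stmt2 {X : Type} [Fintype X] (π : Equiv.Perm X) (hπ : ∀ x, π x ≠ x) :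
    ∃ X1 X2 X3 : Set X,
      Disjoint X1 X2 ∧ Disjoint X1 X3 ∧ Disjoint X2 X3 ∧
      X1 ∪ X2 ∪ X3 = Set.univ ∧
      ∀ S ∈ ({X1, X2, X3} : Set (Set X)), ∀ x ∈ S, ∀ x' ∈ S, x ≠ x' →
        x ≠ π x ∧ x ≠ x' ∧ x ≠ π x' ∧ π x ≠ x' ∧ π x ≠ π x' ∧ x' ≠ π x' := by
  obtain ⟨c, hc⟩ := exists_coloring_aux π hπ Finset.univ
  have hc' : ∀ x, c x ≠ c (π x) := fun x => hc x (Finset.mem_univ _) (Finset.mem_univ _)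
  have hd : ∀ i j : Fin 3, i ≠ j → Disjoint {x | c x = i} {x | c x = j} := by
    intro i j hij
    rw [Set.disjoint_left]
    intro x hx hx'
    exact hij (hx.symm.trans hx')
  refine ⟨{x | c x = 0}, {x | c x = 1}, {x | c x = 2}, hd _ _ (by decide), hd _ _ (by decide),
    hd _ _ (by decide), ?_, ?_⟩
  · ext x
    have key : ∀ k : Fin 3, (k = 0 ∨ k = 1) ∨ k = 2 := by decide
    simpa using key (c x)
  · intro S hS x hx x' hx' hne
    have hcc : c x = c x' := by
      rcases hS with rfl | rfl | rfl <;> exact Eq.trans hx (Eq.symm hx')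
    refine ⟨(hπ x).symm, hne, ?_, ?_, fun h => hne (π.injective h), (hπ x').symm⟩
    · intro h
      exact hc' x' (by rw [← h, hcc])
    · intro h
      exact hc' x (by rw [h, hcc])
end

section
/- Let 𝒟 be a probability mass function on a finite set 𝒳, let f* : 𝒳 → {0,1}, let p = Σ_{x∈𝒳} 𝒟(x)f*(x), and suppose p ∈ [1/2 − γ, 1/2 + γ] for some γ ≥ 0. If φ : 𝒳 → [0,1] satisfies Σ_{x∈𝒳} 𝒟(x)φ(x)f*(x) − p·Σ_{x∈𝒳} 𝒟(x)φ(x) ≥ δ for some δ ≥ 0, then Σ_{x∈𝒳} 𝒟(x)·[φ(x) + f*(x) − 2φ(x)f*(x)] ≤ 1/2 − (2δ − 3γ). (The left-hand side is the expected error Pr_{x∼𝒟}[φ̃(x) ≠ f*(x)] of the randomized rounding φ̃ obtained by sampling each φ̃(x) from Bernoulli(φ(x)) independently.) -/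
open Finset
open scoped BigOperators

noncomputable section

theorem stmt9 {X : Type} [Fintype X] (D : X → ℝ)
    (hD0 : ∀ x, 0 ≤ D x) (hD1 : ∀ x, D x ≤ 1) (hDsum : ∑ x, D x = 1)
    (fstar : X → Bool) (γ δ : ℝ) (hγ : 0 ≤ γ) (hδ : 0 ≤ δ)
    (p : ℝ) (hpdef : p = ∑ x, D x * bval fstar x)
    (hplo : 1 / 2 - γ ≤ p) (hphi : p ≤ 1 / 2 + γ)
    (φ : X → ℝ) (hφ0 : ∀ x, 0 ≤ φ x) (hφ1 : ∀ x, φ x ≤ 1)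
    (hcorr : (∑ x, D x * φ x * bval fstar x) - p * ∑ x, D x * φ x ≥ δ) :
    (∑ x, D x * (φ x + bval fstar x - 2 * φ x * bval fstar x))
      ≤ 1 / 2 - (2 * δ - 3 * γ) := by
  have hm0 : 0 ≤ ∑ x, D x * φ x := Finset.sum_nonneg fun x _ => mul_nonneg (hD0 x) (hφ0 x)
  have hm1 : ∑ x, D x * φ x ≤ 1 := by
    rw [← hDsum]
    exact Finset.sum_le_sum fun x _ => mul_le_of_le_one_right (hD0 x) (hφ1 x)
  have hE : (∑ x, D x * (φ x + bval fstar x - 2 * φ x * bval fstar x))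
      = (∑ x, D x * φ x) + p - 2 * ∑ x, D x * φ x * bval fstar x := by
    rw [hpdef, Finset.mul_sum, ← Finset.sum_add_distrib, ← Finset.sum_sub_distrib]
    exact Finset.sum_congr rfl fun x _ => by ring
  rw [hE]
  have h1 := mul_nonneg hm0 (sub_nonneg.2 hplo)
  have h2 := mul_nonneg hγ (sub_nonneg.2 hm1)
  nlinarith [h1, h2]

end
end

section
/- Let 𝒟 be a probability mass function on a finite set 𝒳, let f* : 𝒳 → {0,1}, let p = Σ_{x∈𝒳} 𝒟(x)f*(x), and suppose p ∈ [1/2 − γ, 1/2 + γ] for some γ ≥ 0. If φ : 𝒳 → [0,1] satisfies Σ_{x∈𝒳} 𝒟(x)φ(x)f*(x) − p·Σ_{x∈𝒳} 𝒟(x)φ(x) ≤ −δ for some δ ≥ 0, then Σ_{x∈𝒳} 𝒟(x)·[(1−φ(x)) + f*(x) − 2(1−φ(x))f*(x)] ≤ 1/2 − (2δ − 3γ). (The left-hand side is the expected error of the randomized rounding of 1 − φ, obtained by sampling each value from Bernoulli(1 − φ(x)) independently.) -/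
open Finset
open scoped BigOperators

noncomputable section

theorem stmt10 {X : Type} [Fintype X] (D : X → ℝ)
    (hD0 : ∀ x, 0 ≤ D x) (hD1 : ∀ x, D x ≤ 1) (hDsum : ∑ x, D x = 1)
    (fstar : X → Bool) (γ δ : ℝ) (hγ : 0 ≤ γ) (hδ : 0 ≤ δ)
    (p : ℝ) (hpdef : p = ∑ x, D x * bval fstar x)
    (hplo : 1 / 2 - γ ≤ p) (hphi : p ≤ 1 / 2 + γ)
    (φ : X → ℝ) (hφ0 : ∀ x, 0 ≤ φ x) (hφ1 : ∀ x, φ x ≤ 1)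
    (hcorr : (∑ x, D x * φ x * bval fstar x) - p * ∑ x, D x * φ x ≤ -δ) :
    (∑ x, D x * ((1 - φ x) + bval fstar x - 2 * (1 - φ x) * bval fstar x))
      ≤ 1 / 2 - (2 * δ - 3 * γ) := by
  have hA0 : 0 ≤ ∑ x, D x * φ x := Finset.sum_nonneg fun x _ => mul_nonneg (hD0 x) (hφ0 x)
  have hA1 : ∑ x, D x * φ x ≤ 1 := by
    rw [← hDsum]
    exact Finset.sum_le_sum fun x _ => mul_le_of_le_one_right (hD0 x) (hφ1 x)
  have key : (∑ x, D x * ((1 - φ x) + bval fstar x - 2 * (1 - φ x) * bval fstar x))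
      = (∑ x, D x) - (∑ x, D x * φ x) - (∑ x, D x * bval fstar x)
        + 2 * ∑ x, D x * φ x * bval fstar x := by
    rw [Finset.mul_sum, ← Finset.sum_sub_distrib, ← Finset.sum_sub_distrib,
      ← Finset.sum_add_distrib]
    exact Finset.sum_congr rfl fun x _ => by ring
  rw [key, hDsum, ← hpdef]
  generalize (∑ x, D x * φ x) = A at *
  generalize (∑ x, D x * φ x * bval fstar x) = B at *
  nlinarith [mul_nonneg hA0 (sub_nonneg.2 hphi), mul_nonneg hγ (sub_nonneg.2 hA1)]

end
end

section
/- Let f be a random p-biased function on 𝒳, let g : 𝒳 → {0,1} be fixed, and define W = Σ_{x∈𝒳} 𝒟_x(x)·[p·(1−y(x))·(1−f(x))·g(x) + (1−p)·y(x)·f(x)·(1−g(x))]. Then E[W] = p(1−p)·Pr_{(x,y)∼𝒟_ref}[g(x) ≠ y], and for every t ≥ 0, Pr[W > E[W] + t] ≤ exp(−2t² / ‖𝒟_x‖₂²). -/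
open Finset Real
open scoped Classical BigOperators

noncomputable section

/-- The random variable `W`. -/
def Wval {X : Type} [Fintype X] (Dx yy : X → ℝ) (p : ℝ) (g f : X → Bool) : ℝ :=
  ∑ x, Dx x * (p * (1 - yy x) * (1 - bval f x) * bval g x
    + (1 - p) * yy x * bval f x * (1 - bval g x))

/-- The error of `g` on the refutation distribution:
`Pr_{(x,y)∼D_ref}[g(x) ≠ y] = Σ_x Dx(x)·[g(x)(1−y(x)) + (1−g(x))y(x)]`. -/
def errRef {X : Type} [Fintype X] (Dx yy : X → ℝ) (g : X → Bool) : ℝ :=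
  ∑ x, Dx x * (bval g x * (1 - yy x) + (1 - bval g x) * yy x)

lemma aux_sum_prod {X : Type} [Fintype X] (G : X → Bool → ℝ) :
    ∑ f : X → Bool, ∏ x, G x (f x) = ∏ x, (G x true + G x false) := by
  have h := Finset.prod_univ_sum (fun _ : X => (Finset.univ : Finset Bool)) G
  simp only [Fintype.piFinset_univ, Fintype.sum_bool] at h
  exact h.symm

lemma aux_bweight_prod {X : Type} [Fintype X] (p : ℝ) (G : X → Bool → ℝ) :
    ∑ f : X → Bool, bweight p f * ∏ x, G x (f x) = ∏ x, (p * G x true + (1 - p) * G x false) := by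
  have h := aux_sum_prod (fun x b => (if b then p else 1 - p) * G x b)
  simp only [Finset.prod_mul_distrib] at h
  simpa [bweight] using h

lemma aux_mean {X : Type} [Fintype X] (p : ℝ) (H : X → Bool → ℝ) :
    ∑ f : X → Bool, bweight p f * ∑ x, H x (f x)
      = ∑ x, (p * H x true + (1 - p) * H x false) := by
  simp only [Finset.mul_sum]
  rw [Finset.sum_comm]
  refine Finset.sum_congr rfl fun x0 _ => ?_
  have h := aux_bweight_prod p (fun x b => if x = x0 then H x b else 1)
  have e : ∀ f : X → Bool, ∏ x, (if x = x0 then H x (f x) else 1) = H x0 (f x0) := by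
    intro f; simp
  simp only [e] at h
  rw [h, Finset.prod_eq_single x0]
  · simp
  · intro b _ hb; simp [hb]
  · simp

lemma aux_hoeff_s16 (p a b D s : ℝ) (hp0 : 0 ≤ p) (hp1 : p ≤ 1) (ha : a ∈ Set.Icc 0 D)
    (hb : b ∈ Set.Icc 0 D) :
    p * exp (s * (a - (p * a + (1 - p) * b))) + (1 - p) * exp (s * (b - (p * a + (1 - p) * b)))
      ≤ exp (s ^ 2 * D ^ 2 / 8) := by
  let μ : MeasureTheory.Measure Bool :=
    ENNReal.ofReal p • MeasureTheory.Measure.dirac true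
      + ENNReal.ofReal (1 - p) • MeasureTheory.Measure.dirac false
  have hμ : MeasureTheory.IsProbabilityMeasure μ := by
    constructor
    simp only [μ, MeasureTheory.Measure.add_apply, MeasureTheory.Measure.smul_apply,
      MeasureTheory.measure_univ, smul_eq_mul, mul_one]
    rw [← ENNReal.ofReal_add hp0 (by linarith)]
    simp
  have hint : ∀ F : Bool → ℝ, ∫ x, F x ∂μ = p * F true + (1 - p) * F false := by
    intro F
    rw [MeasureTheory.integral_add_measure
      (MeasureTheory.Integrable.of_finite.smul_measure ENNReal.ofReal_ne_top)
      (MeasureTheory.Integrable.of_finite.smul_measure ENNReal.ofReal_ne_top)]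
    simp [MeasureTheory.integral_smul_measure, hp0, hp1]
  let Y : Bool → ℝ := fun c => if c then a else b
  have h := ProbabilityTheory.hasSubgaussianMGF_of_mem_Icc (μ := μ) (X := Y) (a := 0) (b := D)
    (measurable_of_finite Y).aemeasurable
    (MeasureTheory.ae_of_all _ (by intro c; cases c <;> simpa [Y]))
  have h2 := h.mgf_le s
  rw [ProbabilityTheory.mgf, hint, hint] at h2
  simp only [Y] at h2
  refine le_trans (by simpa using h2) (le_of_eq ?_)
  rw [div_pow, sq_abs]
  congr 1
  ring

lemma aux_tail {X : Type} [Fintype X] (p : ℝ) (H : X → Bool → ℝ) (D : X → ℝ)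
    (hp0 : 0 ≤ p) (hp1 : p ≤ 1) (hH : ∀ x b, H x b ∈ Set.Icc 0 (D x)) (hN : 0 < norm2sq D)
    (t : ℝ) (ht : 0 ≤ t) :
    bprob X p (fun f => ∑ x, H x (f x) > ∑ x, (p * H x true + (1 - p) * H x false) + t)
      ≤ exp (-(2 * t ^ 2) / norm2sq D) := by
  set N := norm2sq D with hNd
  set s := 4 * t / N with hs
  have hs0 : 0 ≤ s := by positivity
  let m : X → ℝ := fun x => p * H x true + (1 - p) * H x false
  have hw : ∀ f : X → Bool, 0 ≤ bweight p f := by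
    intro f
    refine Finset.prod_nonneg fun x _ => ?_
    split_ifs <;> linarith
  have h1 : bprob X p (fun f => ∑ x, H x (f x) > ∑ x, (p * H x true + (1 - p) * H x false) + t)
      ≤ ∑ f : X → Bool, bweight p f * (exp (-(s * t)) * ∏ x, exp (s * (H x (f x) - m x))) := by
    refine Finset.sum_le_sum fun f _ => mul_le_mul_of_nonneg_left ?_ (hw f)
    rw [← Real.exp_sum, ← Real.exp_add, ← Finset.mul_sum, Finset.sum_sub_distrib]
    split_ifs with hc
    · apply Real.one_le_exp
      have : 0 ≤ s * (∑ x, H x (f x) - ∑ x, m x - t) := by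
        apply mul_nonneg hs0
        simp only [m]
        linarith
      linarith
    · positivity
  have h2 : ∑ f : X → Bool, bweight p f * (exp (-(s * t)) * ∏ x, exp (s * (H x (f x) - m x)))
      = exp (-(s * t)) * ∏ x, (p * exp (s * (H x true - m x))
        + (1 - p) * exp (s * (H x false - m x))) := by
    rw [← aux_bweight_prod p (fun x b => exp (s * (H x b - m x))), Finset.mul_sum]
    exact Finset.sum_congr rfl fun f _ => by ring
  have h3 : ∏ x, (p * exp (s * (H x true - m x)) + (1 - p) * exp (s * (H x false - m x)))
      ≤ ∏ x, exp (s ^ 2 * D x ^ 2 / 8) := by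
    refine Finset.prod_le_prod (fun x _ => ?_) fun x _ =>
      aux_hoeff_s16 p _ _ _ s hp0 hp1 (hH x true) (hH x false)
    have : 0 ≤ 1 - p := by linarith
    positivity
  refine h1.trans (h2.le.trans ((mul_le_mul_of_nonneg_left h3 (exp_pos _).le).trans (le_of_eq ?_)))
  rw [← Real.exp_sum, ← Real.exp_add, ← Finset.sum_div, ← Finset.mul_sum]
  congr 1
  change -(s * t) + s ^ 2 * N / 8 = _
  rw [hs]
  field_simp
  ring

theorem stmt16 {X : Type} [Fintype X] (Dx yy : X → ℝ) (p : ℝ) (g : X → Bool)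
    (hDx0 : ∀ x, 0 ≤ Dx x) (hDx1 : ∀ x, Dx x ≤ 1) (hDxsum : ∑ x, Dx x = 1)
    (hy0 : ∀ x, 0 ≤ yy x) (hy1 : ∀ x, yy x ≤ 1)
    (hp0 : 0 ≤ p) (hp1 : p ≤ 1) :
    (∑ f : X → Bool, bweight p f * Wval Dx yy p g f)
      = p * (1 - p) * errRef Dx yy g ∧
    ∀ t : ℝ, 0 ≤ t →
      bprob X p (fun f => Wval Dx yy p g f > p * (1 - p) * errRef Dx yy g + t)
        ≤ Real.exp (-(2 * t ^ 2) / norm2sq Dx) := by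
  let H : X → Bool → ℝ := fun x b =>
    Dx x * (p * (1 - yy x) * (1 - (if b then 1 else 0)) * bval g x
      + (1 - p) * yy x * (if b then 1 else 0) * (1 - bval g x))
  have hW : ∀ f, Wval Dx yy p g f = ∑ x, H x (f x) := fun f => rfl
  have hE : p * (1 - p) * errRef Dx yy g = ∑ x, (p * H x true + (1 - p) * H x false) := by
    rw [errRef, Finset.mul_sum]
    refine Finset.sum_congr rfl fun x _ => ?_
    simp [H]
    ring
  simp only [hW, hE]
  refine ⟨aux_mean p H, fun t ht => aux_tail p H Dx hp0 hp1 ?_ ?_ t ht⟩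
  · intro x b
    have h0 := hDx0 x
    have h1 := hy0 x
    have h2 : 0 ≤ 1 - yy x := by linarith [hy1 x]
    have h3 : 0 ≤ 1 - p := by linarith
    have k1 : p * (1 - yy x) ≤ 1 := mul_le_one₀ hp1 h2 (by linarith)
    have k2 : (1 - p) * yy x ≤ 1 := mul_le_one₀ (by linarith) h1 (hy1 x)
    have k3 : 0 ≤ p * (1 - yy x) := by positivity
    have k4 : 0 ≤ (1 - p) * yy x := by positivity
    constructor
    · cases b <;> cases hg : g x <;> simp [H, bval, hg] <;> positivity
    · refine mul_le_of_le_one_right h0 ?_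
      cases b <;> cases hg : g x <;> simp [bval, hg] <;> assumption
  · rcases (Finset.sum_nonneg fun x _ => sq_nonneg (Dx x) :
      0 ≤ ∑ x, Dx x ^ 2).lt_or_eq with h | h
    · exact h
    · exfalso
      rw [eq_comm, Finset.sum_eq_zero_iff_of_nonneg fun x _ => sq_nonneg (Dx x)] at h
      have : ∑ x, Dx x = 0 := Finset.sum_eq_zero fun x hx => by simpa using h x hx
      linarith

end
end
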